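/- arXiv:1207.7283 — 7 statements merged into one kernel-verified Lean document; each statement's English description precedes it below -/
import Mathlib

section
/- Let P be an N×N real stochastic matrix (all entries nonnegative, each row summing to 1), and in ℂ^N ⊗ ℂ^N define |ψ_x⟩ = Σ_y √(P_{x,y})·|x,y⟩, T = Σ_x |ψ_x⟩⟨x|, the swap S with S|x,y⟩ = |y,x⟩, the discriminant matrix D_{x,y} = √(P_{x,y}·P_{y,x}), the reflection R₁ = 2TT* − I, and the walk operator W = S·R₁·S·R₁. Suppose v ∈ ℂ^N satisfies Dv = λv for some real λ with −1 ≤ λ ≤ 1, and let θ ∈ [0,π] be the angle with cos θ = λ. Then: (i) W(Tv) = 2λ·(STv) − Tv; (ii) W(STv) = (4λ² − 1)·(STv) − 2λ·(Tv); and consequently (iii) W(STv − e^{−iθ}·Tv) = e^{2iθ}·(STv − e^{−iθ}·Tv) and W(STv − e^{iθ}·Tv) = e^{−2iθ}·(STv − e^{iθ}·Tv), i.e. the two-dimensional subspace spanned by Tv and STv is invariant under W and W acts on it with eigenvalues e^{±2iθ} = (2λ² − 1) ± 2iλ√(1−λ²). -/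
open Matrix in
/-- `T*T = 1`: the states `|ψ_x⟩` of a stochastic matrix are orthonormal. -/
theorem szegedy_isometry {N : ℕ} (P : Matrix (Fin N) (Fin N) ℝ)
    (hP0 : ∀ x y, 0 ≤ P x y) (hP1 : ∀ x, ∑ y, P x y = 1)
    (T : Matrix (Fin N × Fin N) (Fin N) ℂ)
    (hT : T = Matrix.of fun p x => if p.1 = x then ((Real.sqrt (P p.1 p.2) : ℝ) : ℂ) else 0) :
    Tᴴ * T = 1 := by
  subst hT
  ext x y
  have hsq : ∀ a b, ((Real.sqrt (P a b) : ℝ) : ℂ) * ((Real.sqrt (P a b) : ℝ) : ℂ) = (P a b : ℂ) :=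
    fun a b => by rw [← Complex.ofReal_mul, Real.mul_self_sqrt (hP0 a b)]
  rw [Matrix.mul_apply, Fintype.sum_prod_type, Finset.sum_eq_single x]
  · by_cases hxy : x = y
    · subst hxy
      simp only [conjTranspose_apply, of_apply, if_true, Complex.star_def, Complex.conj_ofReal,
        hsq, one_apply_eq]
      exact_mod_cast hP1 x
    · simp [hxy]
  · intro a _ ha
    simp [ha]
  · simp

/-- The swap matrix acts on vectors by exchanging the two tensor factors. -/
theorem swap_mulVec_apply {N : ℕ} (S : Matrix (Fin N × Fin N) (Fin N × Fin N) ℂ)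
    (hS : S = Matrix.of fun p q => if p.1 = q.2 ∧ p.2 = q.1 then 1 else 0)
    (u : Fin N × Fin N → ℂ) (p : Fin N × Fin N) : S.mulVec u p = u p.swap := by
  subst hS
  rw [Matrix.mulVec, dotProduct, Finset.sum_eq_single p.swap]
  · simp
  · rintro ⟨a, b⟩ _ hq
    have : ¬(p.1 = b ∧ p.2 = a) := by
      rintro ⟨rfl, rfl⟩
      exact hq rfl
    simp [this]
  · simp

open Matrix in
/-- `T*ST = D`: the swap compressed to the span of the states `|ψ_x⟩` is the discriminant. -/
theorem szegedy_discriminant {N : ℕ} (P : Matrix (Fin N) (Fin N) ℝ)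
    (hP0 : ∀ x y, 0 ≤ P x y)
    (T : Matrix (Fin N × Fin N) (Fin N) ℂ)
    (hT : T = Matrix.of fun p x => if p.1 = x then ((Real.sqrt (P p.1 p.2) : ℝ) : ℂ) else 0)
    (S : Matrix (Fin N × Fin N) (Fin N × Fin N) ℂ)
    (hS : S = Matrix.of fun p q => if p.1 = q.2 ∧ p.2 = q.1 then 1 else 0)
    (D : Matrix (Fin N) (Fin N) ℂ)
    (hD : D = Matrix.of fun x y => ((Real.sqrt (P x y * P y x) : ℝ) : ℂ)) :
    Tᴴ * (S * T) = D := by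
  have hST : ∀ p y, (S * T) p y = T p.swap y := fun p y =>
    swap_mulVec_apply S hS (fun q => T q y) p
  ext x y
  rw [Matrix.mul_apply, Fintype.sum_prod_type, Finset.sum_eq_single x]
  · rw [Finset.sum_eq_single y]
    · simp only [hST]
      simp [hT, hD, Real.sqrt_mul (hP0 x y)]
    · intro b _ hb
      simp only [hST]
      simp [hT, hb]
    · simp
  · intro a _ ha
    simp [hT, ha]
  · simp


/-- Szegedy's spectral theorem for quantized Markov chains: if `Dv = λv` with
`cos θ = λ`, then the two-dimensional subspace spanned by `Tv` and `STv` is invariant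
under the walk operator `W = S·R₁·S·R₁`, which acts on it with eigenvalues `e^{±2iθ}`. -/
theorem szegedy_walk_spectrum
    (N : ℕ) (P : Matrix (Fin N) (Fin N) ℝ)
    (hP0 : ∀ x y, 0 ≤ P x y) (hP1 : ∀ x, ∑ y, P x y = 1)
    (T : Matrix (Fin N × Fin N) (Fin N) ℂ)
    (hT : T = Matrix.of fun p x => if p.1 = x then ((Real.sqrt (P p.1 p.2) : ℝ) : ℂ) else 0)
    (S : Matrix (Fin N × Fin N) (Fin N × Fin N) ℂ)
    (hS : S = Matrix.of fun p q => if p.1 = q.2 ∧ p.2 = q.1 then 1 else 0)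
    (D : Matrix (Fin N) (Fin N) ℂ)
    (hD : D = Matrix.of fun x y => ((Real.sqrt (P x y * P y x) : ℝ) : ℂ))
    (R1 W : Matrix (Fin N × Fin N) (Fin N × Fin N) ℂ)
    (hR1 : R1 = (2 : ℂ) • (T * T.conjTranspose) - 1)
    (hW : W = S * R1 * S * R1)
    (v : Fin N → ℂ) (lam : ℝ) (hlam : -1 ≤ lam ∧ lam ≤ 1)
    (hv : D.mulVec v = (lam : ℂ) • v)
    (θ : ℝ) (hθ : θ ∈ Set.Icc 0 Real.pi) (hcosθ : Real.cos θ = lam) :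
    W.mulVec (T.mulVec v)
        = ((2 * lam : ℝ) : ℂ) • S.mulVec (T.mulVec v) - T.mulVec v
    ∧ W.mulVec (S.mulVec (T.mulVec v))
        = ((4 * lam ^ 2 - 1 : ℝ) : ℂ) • S.mulVec (T.mulVec v)
          - ((2 * lam : ℝ) : ℂ) • T.mulVec v
    ∧ W.mulVec (S.mulVec (T.mulVec v) - Complex.exp (-(θ : ℂ) * Complex.I) • T.mulVec v)
        = Complex.exp (2 * (θ : ℂ) * Complex.I)
            • (S.mulVec (T.mulVec v) - Complex.exp (-(θ : ℂ) * Complex.I) • T.mulVec v)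
    ∧ W.mulVec (S.mulVec (T.mulVec v) - Complex.exp ((θ : ℂ) * Complex.I) • T.mulVec v)
        = Complex.exp (-(2 * (θ : ℂ)) * Complex.I)
            • (S.mulVec (T.mulVec v) - Complex.exp ((θ : ℂ) * Complex.I) • T.mulVec v)
    ∧ Complex.exp (2 * (θ : ℂ) * Complex.I)
        = ((2 * lam ^ 2 - 1 : ℝ) : ℂ)
          + 2 * Complex.I * (lam : ℂ) * ((Real.sqrt (1 - lam ^ 2) : ℝ) : ℂ)
    ∧ Complex.exp (-(2 * (θ : ℂ)) * Complex.I)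
        = ((2 * lam ^ 2 - 1 : ℝ) : ℂ)
          - 2 * Complex.I * (lam : ℂ) * ((Real.sqrt (1 - lam ^ 2) : ℝ) : ℂ) := by
  have hTT := szegedy_isometry P hP0 hP1 T hT
  have hTST := szegedy_discriminant P hP0 T hT S hS D hD
  have hSS : ∀ u, S.mulVec (S.mulVec u) = u := fun u => by
    ext p
    simp [swap_mulVec_apply S hS]
  have hR1u : ∀ u, R1.mulVec u
      = (2 : ℂ) • T.mulVec (T.conjTranspose.mulVec u) - u := fun u => by
    simp [hR1, Matrix.sub_mulVec, Matrix.smul_mulVec, Matrix.mulVec_mulVec]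
  have hWu : ∀ u, W.mulVec u = S.mulVec (R1.mulVec (S.mulVec (R1.mulVec u))) := fun u => by
    simp [hW, Matrix.mulVec_mulVec, Matrix.mul_assoc]
  have hRa : R1.mulVec (T.mulVec v) = T.mulVec v := by
    rw [hR1u, Matrix.mulVec_mulVec v, hTT, Matrix.one_mulVec]
    module
  have hRb : R1.mulVec (S.mulVec (T.mulVec v))
      = (2 * lam : ℂ) • T.mulVec v - S.mulVec (T.mulVec v) := by
    rw [hR1u, Matrix.mulVec_mulVec v S, Matrix.mulVec_mulVec v T.conjTranspose, hTST, hv,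
      Matrix.mulVec_smul]
    module
  set a := T.mulVec v with ha
  have hSb : S.mulVec (S.mulVec a) = a := hSS a
  set b := S.mulVec a with hb
  have hWa : W.mulVec a = ((2 * lam : ℝ) : ℂ) • b - a := by
    rw [hWu, hRa, ← hb, hRb, Matrix.mulVec_sub, Matrix.mulVec_smul, hSb, ← hb]
    push_cast
    module
  have hWb : W.mulVec b = ((4 * lam ^ 2 - 1 : ℝ) : ℂ) • b - ((2 * lam : ℝ) : ℂ) • a := by
    rw [hWu, hRb, Matrix.mulVec_sub, Matrix.mulVec_smul, hSb, ← hb, Matrix.mulVec_sub,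
      Matrix.mulVec_smul, hRa, hRb, Matrix.mulVec_sub, Matrix.mulVec_smul, Matrix.mulVec_sub,
      Matrix.mulVec_smul, hSb, ← hb]
    push_cast
    module
  have heig : ∀ e f : ℂ, e * f = 1 → e + f = 2 * lam →
      W.mulVec (b - e • a) = f ^ 2 • (b - e • a) := fun e f hef hsum => by
    rw [Matrix.mulVec_sub, Matrix.mulVec_smul, hWa, hWb]
    push_cast
    match_scalars
    · linear_combination (-(2 * lam : ℂ) - f) * hsum + hef
    · linear_combination hsum + f * hef
  have hexp : Complex.exp (θ * Complex.I) = lam + Real.sqrt (1 - lam ^ 2) * Complex.I := by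
    rw [Complex.exp_mul_I, ← Complex.ofReal_cos, ← Complex.ofReal_sin, hcosθ,
      Real.sin_eq_sqrt_one_sub_cos_sq hθ.1 hθ.2, hcosθ]
  have hexp' : Complex.exp (-θ * Complex.I) = lam - Real.sqrt (1 - lam ^ 2) * Complex.I := by
    rw [Complex.exp_mul_I, Complex.cos_neg, Complex.sin_neg, ← Complex.ofReal_cos,
      ← Complex.ofReal_sin, hcosθ, Real.sin_eq_sqrt_one_sub_cos_sq hθ.1 hθ.2, hcosθ]
    ring
  have hsqrt : ((Real.sqrt (1 - lam ^ 2) : ℝ) : ℂ) ^ 2 = 1 - lam ^ 2 := by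
    rw [← Complex.ofReal_pow, Real.sq_sqrt (by nlinarith)]
    push_cast
    ring
  have hdouble : Complex.exp (2 * θ * Complex.I) = Complex.exp (θ * Complex.I) ^ 2 := by
    rw [← Complex.exp_nat_mul]
    push_cast
    ring_nf
  have hdouble' : Complex.exp (-(2 * θ) * Complex.I) = Complex.exp (-θ * Complex.I) ^ 2 := by
    rw [← Complex.exp_nat_mul]
    push_cast
    ring_nf
  have hinv : Complex.exp (θ * Complex.I) * Complex.exp (-θ * Complex.I) = 1 := by
    rw [← Complex.exp_add]
    simp
  have hsum : Complex.exp (θ * Complex.I) + Complex.exp (-θ * Complex.I) = 2 * lam := by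
    rw [hexp, hexp']
    ring
  refine ⟨hWa, hWb, ?_, ?_, ?_, ?_⟩
  · rw [hdouble]
    exact heig _ _ (by rw [mul_comm, hinv]) (by rw [add_comm, hsum])
  · rw [hdouble']
    exact heig _ _ hinv hsum
  · rw [hdouble, hexp]
    push_cast
    linear_combination
      ((Real.sqrt (1 - lam ^ 2) : ℝ) : ℂ) ^ 2 * Complex.I_sq - hsqrt
  · rw [hdouble', hexp']
    push_cast
    linear_combination
      ((Real.sqrt (1 - lam ^ 2) : ℝ) : ℂ) ^ 2 * Complex.I_sq - hsqrt
end

section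
/- Let V be a finite-dimensional complex inner product space and let Π₁, Π₂ : V → V be two orthogonal projections (self-adjoint idempotent linear maps). Then there exists a finite family S₁,…,S_m of nonzero, pairwise orthogonal subspaces of V whose direct sum is all of V, such that each S_i has dimension 1 or 2, each S_i is invariant under both Π₁ and Π₂, and whenever dim S_i = 2, the images Π₁(S_i) and Π₂(S_i) are both one-dimensional (i.e. inside each two-dimensional invariant subspace, Π₁ and Π₂ restrict to rank-one projections). -/
open scoped InnerProductSpace

/-- A nonzero subspace of dimension at most two that is invariant under `P` and `Q`, and on which
both have rank one if the dimension is two. -/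
structure IsJordanBlock {K V : Type*} [Field K] [AddCommGroup V] [Module K V]
    (P Q : V →ₗ[K] V) (S : Submodule K V) : Prop where
  finrank_eq : Module.finrank K S = 1 ∨ Module.finrank K S = 2
  map_left_le : S.map P ≤ S
  map_right_le : S.map Q ≤ S
  finrank_map : Module.finrank K S = 2 →
    Module.finrank K (S.map P) = 1 ∧ Module.finrank K (S.map Q) = 1

theorem IsJordanBlock.ne_bot {K V : Type*} [Field K] [AddCommGroup V] [Module K V]
    {P Q : V →ₗ[K] V} {S : Submodule K V} (hS : IsJordanBlock P Q S) : S ≠ ⊥ := by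
  rintro rfl
  simpa using hS.finrank_eq

/-- If `v` is an eigenvector of the sum of two idempotents `P` and `Q`, then `v` and `P v` span a
Jordan block. -/
theorem isJordanBlock_span_pair {K V : Type*} [Field K] [AddCommGroup V] [Module K V]
    {P Q : V →ₗ[K] V} (hP : ∀ x, P (P x) = P x) (hQ : ∀ x, Q (Q x) = Q x)
    {v : V} (hv : v ≠ 0) {c : K} (hc : P v + Q v = c • v) :
    IsJordanBlock P Q (Submodule.span K {v, P v}) := by
  have hQv : Q v = c • v - P v := eq_sub_of_add_eq' hc
  have hQPv : Q (P v) = (c - 1) • Q v := by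
    rw [eq_sub_of_add_eq hc, map_sub, map_smul, hQ, sub_smul, one_smul]
  have hvS : v ∈ Submodule.span K {v, P v} := Submodule.subset_span (by simp)
  have hPvS : P v ∈ Submodule.span K {v, P v} := Submodule.subset_span (by simp)
  have hQvS : Q v ∈ Submodule.span K {v, P v} :=
    hQv ▸ sub_mem (Submodule.smul_mem _ _ hvS) hPvS
  have hle : Module.finrank K (Submodule.span K {v, P v}) ≤ 2 := by
    classical
    have h := finrank_span_finset_le_card (R := K) ({v, P v} : Finset V)
    rw [Finset.coe_pair] at h
    exact h.trans Finset.card_le_two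
  have hfin : Module.Finite K (Submodule.span K {v, P v}) :=
    Module.Finite.span_of_finite K (Set.toFinite _)
  have hpos : 0 < Module.finrank K (Submodule.span K {v, P v}) :=
    Module.finrank_pos_iff_exists_ne_zero.2 ⟨⟨v, hvS⟩, by simpa using hv⟩
  refine ⟨by omega, ?_, ?_, fun h2 ↦ ?_⟩
  · rw [Submodule.map_span, Submodule.span_le]
    rintro _ ⟨x, rfl | rfl, rfl⟩
    · exact hPvS
    · rw [hP]
      exact hPvS
  · rw [Submodule.map_span, Submodule.span_le]
    rintro _ ⟨x, rfl | rfl, rfl⟩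
    · exact hQvS
    · rw [hQPv]
      exact Submodule.smul_mem _ _ hQvS
  · have hnot : ∀ a : K, P v ≠ a • v := by
      intro a ha
      have hspan : Submodule.span K {v, P v} = Submodule.span K {v} := by
        rw [Set.pair_comm]
        exact Submodule.span_insert_eq_span (Submodule.mem_span_singleton.2 ⟨a, ha.symm⟩)
      rw [hspan, finrank_span_singleton hv] at h2
      omega
    have hP0 : P v ≠ 0 := by simpa using hnot 0
    have hQ0 : Q v ≠ 0 := fun h ↦ hnot c (by simpa [h] using hc)
    constructor
    · rw [Submodule.map_span, Set.image_pair, hP, Set.pair_eq_singleton, finrank_span_singleton hP0]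
    · rw [Submodule.map_span, Set.image_pair, hQPv, Set.pair_comm, Submodule.span_insert_eq_span
        (Submodule.mem_span_singleton.2 ⟨c - 1, rfl⟩), finrank_span_singleton hQ0]

/-- A nonzero common invariant subspace of two idempotents over an algebraically closed field
contains a Jordan block. -/
theorem exists_isJordanBlock_le {K V : Type*} [Field K] [IsAlgClosed K] [AddCommGroup V]
    [Module K V] [FiniteDimensional K V] {P Q : V →ₗ[K] V}
    (hP : ∀ x, P (P x) = P x) (hQ : ∀ x, Q (Q x) = Q x) {W : Submodule K V} (hW : W ≠ ⊥)
    (hPW : ∀ x ∈ W, P x ∈ W) (hQW : ∀ x ∈ W, Q x ∈ W) :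
    ∃ S ≤ W, IsJordanBlock P Q S := by
  have : Nontrivial W := Submodule.nontrivial_iff_ne_bot.2 hW
  obtain ⟨c, hc⟩ := Module.End.exists_eigenvalue
    ((P + Q).restrict fun x hx ↦ W.add_mem (hPW x hx) (hQW x hx))
  obtain ⟨⟨v, hvW⟩, hv⟩ := hc.exists_hasEigenvector
  refine ⟨Submodule.span K {v, P v}, ?_, isJordanBlock_span_pair hP hQ (c := c) ?_ ?_⟩
  · rw [Submodule.span_le]
    rintro _ (rfl | rfl)
    exacts [hvW, hPW _ hvW]
  · simpa using hv.2
  · simpa using congrArg Subtype.val hv.apply_eq_smul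

/-- A symmetric map preserves the orthogonal complement of an invariant subspace. -/
theorem LinearMap.IsSymmetric.apply_mem_orthogonal {𝕜 V : Type*} [RCLike 𝕜]
    [NormedAddCommGroup V] [InnerProductSpace 𝕜 V] {T : V →ₗ[𝕜] V} (hT : T.IsSymmetric)
    {S : Submodule 𝕜 V} (hS : S.map T ≤ S) {x : V} (hx : x ∈ Sᗮ) : T x ∈ Sᗮ :=
  fun y hy ↦ by rw [← hT y x]; exact hx _ (hS ⟨y, hy, rfl⟩)

/-- A common invariant subspace of two orthogonal projections is an orthogonal sum of Jordan
blocks. -/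
theorem exists_orthogonal_isJordanBlock {V : Type*} [NormedAddCommGroup V] [InnerProductSpace ℂ V]
    [FiniteDimensional ℂ V] {P Q : V →ₗ[ℂ] V} (hPs : P.IsSymmetric) (hQs : Q.IsSymmetric)
    (hP : ∀ x, P (P x) = P x) (hQ : ∀ x, Q (Q x) = Q x) (W : Submodule ℂ V)
    (hPW : ∀ x ∈ W, P x ∈ W) (hQW : ∀ x ∈ W, Q x ∈ W) :
    ∃ (m : ℕ) (S : Fin m → Submodule ℂ V),
      (∀ i, IsJordanBlock P Q (S i)) ∧ Pairwise (fun i j ↦ S i ⟂ S j) ∧ (⨆ i, S i) = W := by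
  induction W using WellFoundedLT.induction with
  | ind W ih =>
    by_cases hW : W = ⊥
    · exact ⟨0, Fin.elim0, fun i ↦ i.elim0, fun i ↦ i.elim0, by simp [hW]⟩
    obtain ⟨S, hSW, hS⟩ := exists_isJordanBlock_le hP hQ hW hPW hQW
    have hlt : Sᗮ ⊓ W < W := by
      refine inf_le_right.lt_of_ne fun h ↦ hS.ne_bot ?_
      rw [← le_bot_iff, ← S.inf_orthogonal_eq_bot]
      exact le_inf le_rfl (hSW.trans (inf_eq_right.1 h))
    obtain ⟨m, R, hR, hRo, hRsup⟩ := ih (Sᗮ ⊓ W) hlt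
      (fun x hx ↦ ⟨hPs.apply_mem_orthogonal hS.map_left_le hx.1, hPW x hx.2⟩)
      (fun x hx ↦ ⟨hQs.apply_mem_orthogonal hS.map_right_le hx.1, hQW x hx.2⟩)
    have hSR : ∀ i, S ⟂ R i := fun i ↦ by
      rw [Submodule.isOrtho_comm, Submodule.isOrtho_iff_le]
      exact (le_iSup R i).trans (hRsup.trans_le inf_le_left)
    refine ⟨m + 1, Fin.cons S R, Fin.cases hS hR, ?_, ?_⟩
    · intro i j hij
      induction i using Fin.cases with
      | zero =>
        induction j using Fin.cases with
        | zero => exact absurd rfl hij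
        | succ j => simpa using hSR j
      | succ i =>
        induction j using Fin.cases with
        | zero => simpa using (hSR i).symm
        | succ j => simpa using hRo (by simpa using hij)
    · rw [← (finSuccEquiv m).symm.iSup_comp, iSup_option]
      simp only [finSuccEquiv_symm_none, finSuccEquiv_symm_some, Fin.cons_zero, Fin.cons_succ, hRsup]
      exact Submodule.sup_orthogonal_inf_of_hasOrthogonalProjection hSW

/-- Jordan's lemma on two projections: for any two orthogonal (self-adjoint idempotent)
projections on a finite-dimensional complex inner product space, the space decomposes
into an orthogonal direct sum of nonzero subspaces of dimension 1 or 2 invariant under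
both projections, and inside each 2-dimensional piece both projections have rank one. -/
theorem jordan_two_projections
    {V : Type*} [NormedAddCommGroup V] [InnerProductSpace ℂ V] [FiniteDimensional ℂ V]
    (Pi1 Pi2 : V →ₗ[ℂ] V)
    (h1sa : ∀ x y : V, ⟪Pi1 x, y⟫_ℂ = ⟪x, Pi1 y⟫_ℂ) (h1idem : Pi1 ∘ₗ Pi1 = Pi1)
    (h2sa : ∀ x y : V, ⟪Pi2 x, y⟫_ℂ = ⟪x, Pi2 y⟫_ℂ) (h2idem : Pi2 ∘ₗ Pi2 = Pi2) :
    ∃ (m : ℕ) (S : Fin m → Submodule ℂ V),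
      (∀ i, S i ≠ ⊥) ∧
      (∀ i j, i ≠ j → ∀ x ∈ S i, ∀ y ∈ S j, ⟪x, y⟫_ℂ = 0) ∧
      (⨆ i, S i) = ⊤ ∧
      (∀ i, Module.finrank ℂ (S i) = 1 ∨ Module.finrank ℂ (S i) = 2) ∧
      (∀ i, Submodule.map Pi1 (S i) ≤ S i) ∧
      (∀ i, Submodule.map Pi2 (S i) ≤ S i) ∧
      (∀ i, Module.finrank ℂ (S i) = 2 →
        Module.finrank ℂ (Submodule.map Pi1 (S i)) = 1 ∧
        Module.finrank ℂ (Submodule.map Pi2 (S i)) = 1) := by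
  obtain ⟨m, S, hS, hSo, hSsup⟩ := exists_orthogonal_isJordanBlock h1sa h2sa
    (LinearMap.congr_fun h1idem) (LinearMap.congr_fun h2idem) ⊤ (by simp) (by simp)
  exact ⟨m, S, fun i ↦ (hS i).ne_bot,
    fun i j hij _ hx _ hy ↦ Submodule.isOrtho_iff_inner_eq.1 (hSo hij) _ hx _ hy, hSsup,
    fun i ↦ (hS i).finrank_eq, fun i ↦ (hS i).map_left_le, fun i ↦ (hS i).map_right_le,
    fun i ↦ (hS i).finrank_map⟩
end

section
/- Let (Ω, μ) be a probability space, let ℓ ≥ 1 be an integer, let 0 < ε ≤ 1, let α₀,…,α_{ℓ−1} be positive real numbers with product α = α₀·α₁·⋯·α_{ℓ−1}, and let Q₀,…,Q_{ℓ−1} : Ω → ℝ be random variables such that for each i, μ{ω : |Q_i(ω) − α_i| ≤ ε·α_i/(2ℓ)} ≥ 1 − 1/(4ℓ). Then the product Q = Q₀·Q₁·⋯·Q_{ℓ−1} satisfies μ{ω : (1−ε)·α ≤ Q(ω) ≤ (1+ε)·α} ≥ 3/4. -/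
open MeasureTheory

/-- **Union bound**: if each event `E i` fails with probability at most `δ i`, then all of them
hold simultaneously with probability at least `1 - ∑ i, δ i`. -/
theorem one_sub_sum_le_measure_iInter {Ω ι : Type*} [Fintype ι] [MeasurableSpace Ω]
    (μ : Measure Ω) [IsProbabilityMeasure μ] {E : ι → Set Ω} (hE : ∀ i, MeasurableSet (E i))
    {δ : ι → ENNReal} (h : ∀ i, 1 - δ i ≤ μ (E i)) :
    1 - ∑ i, δ i ≤ μ (⋂ i, E i) := by
  rw [tsub_le_iff_right, ← prob_add_prob_compl (μ := μ) (MeasurableSet.iInter hE),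
    Set.compl_iInter]
  gcongr
  refine (measure_iUnion_fintype_le μ _).trans (Finset.sum_le_sum fun i _ => ?_)
  rw [prob_compl_eq_one_sub (hE i), tsub_le_iff_left]
  exact tsub_le_iff_right.1 (h i)

theorem one_add_div_two_mul_pow_le {ε : ℝ} (hε0 : 0 ≤ ε) (hε1 : ε ≤ 1) {n : ℕ} (hn : n ≠ 0) :
    (1 + ε / (2 * n)) ^ n ≤ 1 + ε := by
  calc (1 + ε / (2 * n)) ^ n ≤ Real.exp (ε / (2 * n)) ^ n := by
        gcongr
        rw [add_comm]
        exact Real.add_one_le_exp _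
    _ = Real.exp (ε / 2) := by
        rw [← Real.exp_nat_mul]
        congr 1
        field_simp
    _ ≤ 1 / (1 - ε / 2) := Real.exp_bound_div_one_sub_of_interval (by linarith) (by linarith)
    _ ≤ 1 + ε := by
        rw [div_le_iff₀ (by linarith)]
        nlinarith

theorem one_sub_le_one_sub_div_two_mul_pow {ε : ℝ} (hε0 : 0 ≤ ε) (hε1 : ε ≤ 1) {n : ℕ}
    (hn : n ≠ 0) : 1 - ε ≤ (1 - ε / (2 * n)) ^ n := by
  have hn1 : (1 : ℝ) ≤ n := by exact_mod_cast Nat.one_le_iff_ne_zero.2 hn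
  have hle : ε / (2 * n) ≤ 1 := by
    rw [div_le_one (by positivity)]
    linarith
  have hmul : (n : ℝ) * (ε / (2 * n)) = ε / 2 := by field_simp
  have := one_add_mul_le_pow (a := -(ε / (2 * n))) (by linarith) n
  rw [← sub_eq_add_neg] at this
  linarith

/-- Factors with relative error at most `ε / (2 * n)`, where `n` is the number of factors, have a
product with relative error at most `ε`. -/
theorem prod_mem_Icc_of_abs_sub_le {n : ℕ} (hn : n ≠ 0) {ε : ℝ} (hε0 : 0 ≤ ε) (hε1 : ε ≤ 1)
    {a q : Fin n → ℝ} (ha : ∀ i, 0 ≤ a i) (hq : ∀ i, |q i - a i| ≤ ε * a i / (2 * n)) :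
    ∏ i, q i ∈ Set.Icc ((1 - ε) * ∏ i, a i) ((1 + ε) * ∏ i, a i) := by
  have hn1 : (1 : ℝ) ≤ n := by exact_mod_cast Nat.one_le_iff_ne_zero.2 hn
  have hle : ε / (2 * n) ≤ 1 := by
    rw [div_le_one (by positivity)]
    linarith
  have hprod : 0 ≤ ∏ i, a i := Finset.prod_nonneg fun i _ => ha i
  have hlow : ∀ i, (1 - ε / (2 * n)) * a i ≤ q i := fun i => by
    have := (abs_le.1 (hq i)).1
    rw [mul_div_right_comm] at this
    linarith
  have hup : ∀ i, q i ≤ (1 + ε / (2 * n)) * a i := fun i => by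
    have := (abs_le.1 (hq i)).2
    rw [mul_div_right_comm] at this
    linarith
  have hnonneg : ∀ i, 0 ≤ (1 - ε / (2 * n)) * a i := fun i =>
    mul_nonneg (by linarith) (ha i)
  constructor
  · calc (1 - ε) * ∏ i, a i ≤ (1 - ε / (2 * n)) ^ n * ∏ i, a i := by
          gcongr
          exact one_sub_le_one_sub_div_two_mul_pow hε0 hε1 hn
      _ = ∏ i, (1 - ε / (2 * n)) * a i := by simp [Finset.prod_mul_distrib]
      _ ≤ ∏ i, q i := Finset.prod_le_prod (fun i _ => hnonneg i) fun i _ => hlow i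
  · calc ∏ i, q i ≤ ∏ i, (1 + ε / (2 * n)) * a i :=
          Finset.prod_le_prod (fun i _ => (hnonneg i).trans (hlow i)) fun i _ => hup i
      _ = (1 + ε / (2 * n)) ^ n * ∏ i, a i := by simp [Finset.prod_mul_distrib]
      _ ≤ (1 + ε) * ∏ i, a i := by
          gcongr
          exact one_add_div_two_mul_pow_le hε0 hε1 hn

/-- Composing ratio estimates: if each random variable `Q_i` estimates `α_i` within a
relative error `ε/(2ℓ)` with probability at least `1 − 1/(4ℓ)`, then the product
`Q = Q_0⋯Q_{ℓ−1}` is within relative error `ε` of `α = α_0⋯α_{ℓ−1}` with probability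
at least `3/4`. -/
theorem compose_ratio_estimates
    {Ω : Type*} [MeasurableSpace Ω] (μ : Measure Ω) [IsProbabilityMeasure μ]
    (ℓ : ℕ) (hℓ : 1 ≤ ℓ) (ε : ℝ) (hε0 : 0 < ε) (hε1 : ε ≤ 1)
    (α : Fin ℓ → ℝ) (hα : ∀ i, 0 < α i)
    (Q : Fin ℓ → Ω → ℝ) (hQmeas : ∀ i, Measurable (Q i))
    (hQ : ∀ i, 1 - 1 / (4 * (ℓ : ENNReal))
      ≤ μ {ω | |Q i ω - α i| ≤ ε * α i / (2 * ℓ)}) :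
    (3 : ENNReal) / 4
      ≤ μ {ω | (1 - ε) * ∏ i, α i ≤ ∏ i, Q i ω ∧ ∏ i, Q i ω ≤ (1 + ε) * ∏ i, α i} := by
  have hℓ0 : ℓ ≠ 0 := Nat.one_le_iff_ne_zero.1 hℓ
  have hmeas : ∀ i, MeasurableSet {ω | |Q i ω - α i| ≤ ε * α i / (2 * ℓ)} := fun i =>
    measurableSet_le ((hQmeas i).sub_const _).abs measurable_const
  have hsum : ∑ _i : Fin ℓ, 1 / (4 * (ℓ : ENNReal)) = 1 / 4 := by
    rw [Finset.sum_const, Finset.card_univ, Fintype.card_fin, nsmul_eq_mul, mul_one_div,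
      mul_comm 4]
    simpa using ENNReal.mul_div_mul_left 1 4 (Nat.cast_ne_zero.2 hℓ0)
      (ENNReal.natCast_ne_top ℓ)
  have hquarter : (3 : ENNReal) / 4 = 1 - 1 / 4 := by
    refine ENNReal.eq_sub_of_add_eq (by simp) ?_
    rw [ENNReal.div_add_div_same, show (3 : ENNReal) + 1 = 4 by norm_num]
    exact ENNReal.div_self (by simp) (by simp)
  rw [hquarter, ← hsum]
  refine (one_sub_sum_le_measure_iInter μ hmeas hQ).trans (measure_mono fun ω hω => ?_)
  exact prod_mem_Icc_of_abs_sub_le hℓ0 hε0.le hε1 (fun i => (hα i).le) (Set.mem_iInter.1 hω)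
end

section
/- Let Ω be a finite nonempty set, let E : Ω → ℝ be a nonnegative function, let 0 ≤ β_i ≤ β_{i+1} be real numbers, and set Z_i = Σ_{σ∈Ω} e^{−β_i·E(σ)} and Z_{i+1} = Σ_{σ∈Ω} e^{−β_{i+1}·E(σ)}. If Z_{i+1}/Z_i ≥ 1/2, then ( Σ_{σ∈Ω} e^{−(β_i + β_{i+1})·E(σ)/2} )² / (Z_i·Z_{i+1}) ≥ 1/2. -/
/-- Overlap bound for consecutive quantum samples in quantized MCMC: if the ratio of
Gibbs partition functions at successive inverse temperatures `β_i ≤ β_{i+1}` is at least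
`1/2`, then the squared overlap `(Σ_σ e^{−(β_i+β_{i+1})E(σ)/2})²/(Z_i·Z_{i+1})` is at
least `1/2`. -/
theorem gibbs_overlap_bound
    {Ω : Type*} [Fintype Ω] [Nonempty Ω]
    (E : Ω → ℝ) (hE : ∀ σ, 0 ≤ E σ)
    (βi βj : ℝ) (hβ0 : 0 ≤ βi) (hββ : βi ≤ βj)
    (Zi Zj : ℝ)
    (hZi : Zi = ∑ σ, Real.exp (-(βi * E σ)))
    (hZj : Zj = ∑ σ, Real.exp (-(βj * E σ)))
    (hratio : 1 / 2 ≤ Zj / Zi) :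
    1 / 2 ≤ (∑ σ, Real.exp (-((βi + βj) * E σ / 2))) ^ 2 / (Zi * Zj) := by
  have hZi_pos : 0 < Zi := hZi ▸ Finset.sum_pos (fun σ _ => Real.exp_pos _) Finset.univ_nonempty
  have hZj_pos : 0 < Zj := hZj ▸ Finset.sum_pos (fun σ _ => Real.exp_pos _) Finset.univ_nonempty
  have hle : Zj ≤ ∑ σ, Real.exp (-((βi + βj) * E σ / 2)) := by
    rw [hZj]
    refine Finset.sum_le_sum fun σ _ => Real.exp_le_exp.mpr ?_
    linarith [mul_le_mul_of_nonneg_right hββ (hE σ)]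
  calc 1 / 2 ≤ Zj / Zi := hratio
    _ = Zj ^ 2 / (Zi * Zj) := by field_simp
    _ ≤ _ := by gcongr
end

section
/- Let C_k = (1/(k+1))·binom(2k,k) denote the k-th Catalan number. Then Σ_{k=0}^∞ C_k² / 16^k = 16/π − 4. Equivalently, 1/2 + (1/8)·Σ_{k=0}^∞ C_k²/2^{4k} = 2/π. -/
open Filter Finset Topology Real.Wallis in
/-- The square of the central binomial coefficient in terms of the partial Wallis product. -/
theorem sq_choose_two_mul_self_div_sixteen_pow (n : ℕ) :
    (Nat.choose (2 * n) n : ℝ) ^ 2 / 16 ^ n = 1 / ((2 * n + 1) * W n) := by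
  have h : ((Nat.choose (2 * n) n : ℕ) : ℝ) = (2 * n).factorial / (n.factorial : ℝ) ^ 2 := by
    rw [Nat.cast_choose ℝ (by lia), show 2 * n - n = n by lia, sq]
  have h16 : (2 : ℝ) ^ (4 * n) = 16 ^ n := by rw [pow_mul]; norm_num
  rw [h, W_eq_factorial_ratio, h16]
  have := Nat.factorial_ne_zero n
  have := Nat.factorial_ne_zero (2 * n)
  field_simp

open Filter Finset Topology Real.Wallis in
/-- The partial sums of `∑ C_k² / 16 ^ k` in closed form. -/
theorem sum_range_sq_catalan_div_sixteen_pow (n : ℕ) :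
    ∑ k ∈ range n, ((Nat.choose (2 * k) k : ℝ) / (k + 1)) ^ 2 / 16 ^ k
      = (16 * n + 4) / (2 * n + 1) / W n - 4 := by
  induction n with
  | zero => simp [W]
  | succ n ih =>
    have hW := (W_pos n).ne'
    rw [sum_range_succ, ih, div_pow, div_right_comm (_ ^ 2), sq_choose_two_mul_self_div_sixteen_pow,
      W_succ]
    push_cast
    have : (2 * (n : ℝ) + 1) ≠ 0 := by positivity
    have : (2 * (n : ℝ) + 3) ≠ 0 := by positivity
    have : (2 * ((n : ℝ) + 1) + 1) ≠ 0 := by positivity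
    field_simp
    ring

open Filter Finset Topology Real.Wallis in
theorem hasSum_sq_catalan_div_sixteen_pow :
    HasSum (fun k : ℕ => ((Nat.choose (2 * k) k : ℝ) / (k + 1)) ^ 2 / 16 ^ k)
      (16 / Real.pi - 4) := by
  rw [hasSum_iff_tendsto_nat_of_nonneg (fun k => by positivity)]
  simp_rw [sum_range_sq_catalan_div_sixteen_pow]
  have h : Tendsto (fun n : ℕ => (16 * (n : ℝ) + 4) / (2 * n + 1)) atTop (𝓝 8) := by
    have h₁ : Tendsto (fun n : ℕ => 8 - 4 / (2 * (n : ℝ) + 1)) atTop (𝓝 (8 - 0)) :=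
      (tendsto_const_nhds.div_atTop (tendsto_atTop_add_const_right _ _
        (tendsto_natCast_atTop_atTop.const_mul_atTop two_pos))).const_sub _
    rw [sub_zero] at h₁
    refine h₁.congr fun n => ?_
    field_simp
    ring
  have h₂ := (h.div tendsto_W_nhds_pi_div_two (by positivity)).sub_const 4
  rwa [show (8 : ℝ) / (Real.pi / 2) = 16 / Real.pi by field_simp; norm_num] at h₂

/-- The Catalan-number series identity behind the absorption probability `2/π` of the
Hadamard quantum walk on the half-line: `Σ_k C_k²/16^k = 16/π − 4`, equivalently
`1/2 + (1/8)·Σ_k C_k²/2^{4k} = 2/π`, where `C_k = binom(2k,k)/(k+1)`. -/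
theorem catalan_series_value :
    (∑' k : ℕ, ((Nat.choose (2 * k) k : ℝ) / (k + 1)) ^ 2 / 16 ^ k) = 16 / Real.pi - 4
    ∧ 1 / 2 + (1 / 8) * (∑' k : ℕ, ((Nat.choose (2 * k) k : ℝ) / (k + 1)) ^ 2 / 2 ^ (4 * k))
        = 2 / Real.pi := by
  have h := hasSum_sq_catalan_div_sixteen_pow.tsum_eq
  refine ⟨h, ?_⟩
  have h16 (k : ℕ) : (2 : ℝ) ^ (4 * k) = 16 ^ k := by rw [pow_mul]; norm_num
  simp_rw [h16]
  rw [h]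
  ring
end

section
/- Let C_k = (1/(k+1))·binom(2k,k) denote the k-th Catalan number. Then for every natural number M, Σ_{k=0}^{M} C_k² / 16^k = (16M³ + 36M² + 24M + 5)·C_M²/16^M − 4. -/
/-- The Catalan recurrence `C_{k+1} = 2(2k+1)/(k+2) · C_k`, over the reals. -/
theorem choose_two_mul_div_succ (k : ℕ) :
    (Nat.choose (2 * (k + 1)) (k + 1) : ℝ) / ((k + 1 : ℕ) + 1)
      = 2 * (2 * k + 1) / (k + 2) * ((Nat.choose (2 * k) k : ℝ) / (k + 1)) := by
  have h : ((k : ℝ) + 1) * Nat.choose (2 * (k + 1)) (k + 1)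
      = 2 * (2 * k + 1) * Nat.choose (2 * k) k := by
    exact_mod_cast Nat.succ_mul_centralBinom_succ k
  have hk : (k : ℝ) + 1 ≠ 0 := by positivity
  have hk' : (k : ℝ) + 2 ≠ 0 := by positivity
  have hcast : ((k + 1 : ℕ) : ℝ) + 1 = k + 2 := by push_cast; ring
  rw [hcast, div_mul_div_comm, div_eq_div_iff hk' (mul_ne_zero hk' hk)]
  linear_combination ((k : ℝ) + 2) * h

/-- Closed form for the partial sums of `C_k²/16^k`, where `C_k = binom(2k,k)/(k+1)` is
the `k`-th Catalan number:
`Σ_{k=0}^{M} C_k²/16^k = (16M³ + 36M² + 24M + 5)·C_M²/16^M − 4`. -/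
theorem catalan_partial_sum (M : ℕ) :
    ∑ k ∈ Finset.range (M + 1), ((Nat.choose (2 * k) k : ℝ) / (k + 1)) ^ 2 / 16 ^ k
      = (16 * (M : ℝ) ^ 3 + 36 * (M : ℝ) ^ 2 + 24 * (M : ℝ) + 5)
          * ((Nat.choose (2 * M) M : ℝ) / (M + 1)) ^ 2 / 16 ^ M - 4 := by
  induction M with
  | zero => norm_num
  | succ M ih =>
    rw [Finset.sum_range_succ, ih, choose_two_mul_div_succ]
    generalize (Nat.choose (2 * M) M : ℝ) / (M + 1) = c
    have hM : (M : ℝ) + 2 ≠ 0 := by positivity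
    push_cast
    field_simp
    ring
end

section
/- Let C_k = (1/(k+1))·binom(2k,k) denote the k-th Catalan number. Then the series of nonnegative terms Σ_{k=0}^∞ (2k+1)·C_k / 2^{2k+1} is not summable, i.e. its partial sums tend to +∞. -/
/-- Each term of the series dominates half the corresponding term of the harmonic series. -/
theorem half_one_div_succ_le_catalan_term (k : ℕ) :
    1 / 2 * (1 / ((k : ℝ) + 1)) ≤
      (2 * (k : ℝ) + 1) * ((Nat.choose (2 * k) k : ℝ) / (k + 1)) / 2 ^ (2 * k + 1) := by
  have h : (4 : ℝ) ^ k ≤ (2 * (k : ℝ) + 1) * Nat.choose (2 * k) k := by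
    exact_mod_cast Nat.four_pow_le_two_mul_add_one_mul_central_binom k
  calc 1 / 2 * (1 / ((k : ℝ) + 1)) = 4 ^ k / (k + 1) / 2 ^ (2 * k + 1) := by
        rw [pow_succ, pow_mul]
        norm_num
        field_simp
    _ ≤ (2 * (k : ℝ) + 1) * Nat.choose (2 * k) k / (k + 1) / 2 ^ (2 * k + 1) := by gcongr
    _ = _ := by rw [mul_div_assoc (2 * (k : ℝ) + 1)]


/-- Divergence of the expected hitting time of the symmetric random walk on ℤ: the series
`Σ_k (2k+1)·C_k/2^{2k+1}`, with `C_k = binom(2k,k)/(k+1)` the `k`-th Catalan number, is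
not summable, and its partial sums tend to `+∞`. -/
theorem catalan_hitting_time_divergence :
    ¬ Summable (fun k : ℕ =>
        (2 * (k : ℝ) + 1) * ((Nat.choose (2 * k) k : ℝ) / (k + 1)) / 2 ^ (2 * k + 1))
    ∧ Filter.Tendsto
        (fun n : ℕ => ∑ k ∈ Finset.range n,
          (2 * (k : ℝ) + 1) * ((Nat.choose (2 * k) k : ℝ) / (k + 1)) / 2 ^ (2 * k + 1))
        Filter.atTop Filter.atTop := by
  rw [← not_summable_iff_tendsto_nat_atTop_of_nonneg fun k => by positivity, and_self]
  intro hs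
  have hh : Summable fun k : ℕ => 1 / 2 * (1 / ((k : ℝ) + 1)) :=
    hs.of_nonneg_of_le (fun k => by positivity) half_one_div_succ_le_catalan_term
  rw [summable_mul_left_iff (by norm_num)] at hh
  refine Real.not_summable_one_div_natCast ((summable_nat_add_iff 1).mp ?_)
  simpa using hh
end
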